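/- arXiv:1509.01300 — 2 statements merged into one kernel-verified Lean document; each statement's English description precedes it below -/
import Mathlib

section
/- If M is a complex matrix indexed by Fin d × Fin d such that M is positive semidefinite, its partial transpose M^Γ is positive semidefinite, and trace(M · (I − Φ)) = 0, then M = 0. -/
open Matrix Kronecker ComplexOrder

/-- Projector onto the maximally entangled state: Φ[(i,j),(k,l)] = 1/d if i=j and k=l. -/
noncomputable def Phi (d : ℕ) : Matrix (Fin d × Fin d) (Fin d × Fin d) ℂ :=
  fun p q => if p.1 = p.2 ∧ q.1 = q.2 then ((d : ℂ))⁻¹ else 0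

/-- Partial transpose: M^Γ[(i,j),(k,l)] = M[(i,l),(k,j)]. -/
def ptrans (d : ℕ) (M : Matrix (Fin d × Fin d) (Fin d × Fin d) ℂ) :
    Matrix (Fin d × Fin d) (Fin d × Fin d) ℂ :=
  fun x y => M (x.1, y.2) (y.1, x.2)

theorem psd_zero_entry {n : Type*} [Fintype n] [DecidableEq n] {A : Matrix n n ℂ}
    (hA : A.PosSemidef) (p q : n) (h : A q q = 0) : A p q = 0 := by
  have h1 : A *ᵥ (Pi.single q 1) = 0 := by
    rw [← hA.dotProduct_mulVec_zero_iff]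
    simp [h]
  have h2 := congrFun h1 p
  simpa using h2

theorem Phi_herm (d : ℕ) : (Phi d)ᴴ = Phi d := by
  ext p q
  simp only [conjTranspose_apply, Phi, and_comm]
  split_ifs <;> simp

theorem mul_Phi (d : ℕ) (M : Matrix (Fin d × Fin d) (Fin d × Fin d) ℂ) (p q : Fin d × Fin d) :
    (M * Phi d) p q = if q.1 = q.2 then (∑ i, M p (i, i)) * (d : ℂ)⁻¹ else 0 := by
  simp only [Matrix.mul_apply, Phi, Fintype.sum_prod_type]
  split_ifs with h
  · simp [h, Finset.sum_mul]
  · simp [h]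

theorem Phi_idem (d : ℕ) (hd : 2 ≤ d) : Phi d * Phi d = Phi d := by
  have : (d : ℂ) ≠ 0 := by
    have : d ≠ 0 := by omega
    exact_mod_cast this
  ext p q
  rw [mul_Phi]
  by_cases h : q.1 = q.2 <;> by_cases h' : p.1 = p.2 <;> simp [Phi, h, h', this]

/-- A PPT matrix M with trace(M · (I − Φ)) = 0 must be zero. -/
theorem stmt_3 (d : ℕ) (hd : 2 ≤ d) (M : Matrix (Fin d × Fin d) (Fin d × Fin d) ℂ)
    (hM : M.PosSemidef) (hMpt : (ptrans d M).PosSemidef)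
    (htr : (M * ((1 : Matrix (Fin d × Fin d) (Fin d × Fin d) ℂ) - Phi d)).trace = 0) :
    M = 0 := by
  set Q : Matrix (Fin d × Fin d) (Fin d × Fin d) ℂ := 1 - Phi d with hQ
  have hQh : Qᴴ = Q := by rw [hQ, conjTranspose_sub, Phi_herm, conjTranspose_one]
  have hQQ : Q * Q = Q := by
    rw [hQ, sub_mul, mul_sub, mul_sub, Phi_idem d hd]; simp
  have h0 : Qᴴ * M * Q = 0 := by
    rw [← (hM.conjTranspose_mul_mul_same Q).trace_eq_zero_iff, hQh, Matrix.mul_assoc,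
      Matrix.trace_mul_comm, Matrix.mul_assoc, hQQ, htr]
  have hMQ : M * Q = 0 := by
    apply Matrix.ext_of_mulVec_single
    intro i
    rw [← Matrix.mulVec_mulVec, Matrix.zero_mulVec, ← hM.dotProduct_mulVec_zero_iff,
      Matrix.star_mulVec, ← Matrix.dotProduct_mulVec, Matrix.mulVec_mulVec, Matrix.mulVec_mulVec,
      h0]
    simp
  have hMP : M = M * Phi d := by
    rw [hQ, mul_sub, Matrix.mul_one, sub_eq_zero] at hMQ
    exact hMQ
  have e : ∀ p q, M p q = if q.1 = q.2 then (∑ i, M p (i, i)) * (d : ℂ)⁻¹ else 0 := by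
    intro p q
    rw [← mul_Phi, ← hMP]
  have off : ∀ i j, i ≠ j → M (i, i) (j, j) = 0 := by
    intro i j hij
    refine psd_zero_entry hMpt (i, j) (j, i) ?_
    change M (j, i) (j, i) = 0
    rw [e]
    simp [hij.symm]
  rw [← hM.trace_eq_zero_iff]
  refine Finset.sum_eq_zero ?_
  rintro ⟨i, j⟩ -
  rw [diag_apply]
  by_cases hij : i = j
  · subst hij
    have : Nontrivial (Fin d) := Fin.nontrivial_iff_two_le.mpr hd
    obtain ⟨k, hk⟩ := exists_ne i
    have h1 := off i k hk.symm
    rw [e] at h1 ⊢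
    simpa using h1
  · rw [e]
    simp [hij]
end

section
/- Let μ be the Haar probability measure on the compact group of d×d complex unitary matrices (Matrix.unitaryGroup (Fin d) ℂ). For every integer a with 1 ≤ a ≤ d−1, the matrix-valued Haar average ∫ (U† · Zᵃ · U) ⊗ₖ conj(U† · Zᵃ · U) dμ(U), where conj denotes the entrywise complex conjugate, equals Φ − (1/(d²−1)) • (I − Φ), where I is the identity matrix indexed by Fin d × Fin d. -/
open Matrix MeasureTheory Kronecker

attribute [local instance] Matrix.normedAddCommGroup Matrix.normedSpace

/-- Borel measurable structure on complex matrices. -/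
noncomputable instance (d : ℕ) : MeasurableSpace (Matrix (Fin d) (Fin d) ℂ) := borel _

instance (d : ℕ) : BorelSpace (Matrix (Fin d) (Fin d) ℂ) := ⟨rfl⟩

/-- The diagonal matrix Z with Z[j,j] = ω^j, ω = exp(2πi/d). -/
noncomputable def Zmat (d : ℕ) : Matrix (Fin d) (Fin d) ℂ :=
  Matrix.diagonal fun j => Complex.exp (2 * Real.pi * Complex.I / d) ^ (j : ℕ)

instance instCompU (d : ℕ) : CompactSpace (Matrix.unitaryGroup (Fin d) ℂ) := by
  refine (isCompact_iff_compactSpace (s := (Matrix.unitaryGroup (Fin d) ℂ : Set (Matrix (Fin d) (Fin d) ℂ)))).1 ?_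
  refine Metric.isCompact_of_isClosed_isBounded ?_ ?_
  · exact isClosed_unitary (R := Matrix (Fin d) (Fin d) ℂ)
  · refine (Metric.isBounded_closedBall (x := (0 : Matrix (Fin d) (Fin d) ℂ)) (r := 1)).subset ?_
    intro U hU
    rw [mem_closedBall_zero_iff]
    exact entrywise_sup_norm_bound_of_unitary hU

lemma right_inv (d : ℕ)
    (μ : Measure (Matrix.unitaryGroup (Fin d) ℂ)) [IsProbabilityMeasure μ]
    (hinv : ∀ V : Matrix.unitaryGroup (Fin d) ℂ, Measure.map (fun U => V * U) μ = μ) :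
    μ.IsMulRightInvariant := by
  have : IsTopologicalGroup (Matrix.unitaryGroup (Fin d) ℂ) := inferInstanceAs (IsTopologicalGroup (unitary _))
  have : μ.IsMulLeftInvariant := ⟨hinv⟩
  have : μ.IsOpenPosMeasure := isOpenPosMeasure_of_mulLeftInvariant_of_compact Set.univ isCompact_univ (by simp)
  have : μ.IsHaarMeasure := {}
  refine ⟨fun g => ?_⟩
  have h := Measure.isMulInvariant_eq_smul_of_compactSpace (Measure.map (· * g) μ) μ
  have h2 : Measure.map (· * g) μ Set.univ = 1 := by
    rw [Measure.map_apply (measurable_mul_const g) MeasurableSet.univ]; simp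
  have h3 := h2
  rw [h] at h3
  simp at h3
  rw [h, h3, one_smul]

noncomputable def Amat (d a : ℕ) (U : Matrix.unitaryGroup (Fin d) ℂ) : Matrix (Fin d) (Fin d) ℂ :=
  star (U : Matrix (Fin d) (Fin d) ℂ) * (Zmat d) ^ a * (U : Matrix (Fin d) (Fin d) ℂ)

lemma Amat_cont (d a : ℕ) : Continuous (Amat d a) := by
  unfold Amat
  fun_prop

lemma Amat_mul (d a : ℕ) (U W : Matrix.unitaryGroup (Fin d) ℂ) :
    Amat d a (U * W) = star (W : Matrix (Fin d) (Fin d) ℂ) * Amat d a U * (W : Matrix (Fin d) (Fin d) ℂ) := by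
  simp [Amat, mul_assoc]

lemma Z_unit (d a : ℕ) : Zmat d ^ a * star (Zmat d ^ a) = 1 := by
  have h : Zmat d ∈ unitary (Matrix (Fin d) (Fin d) ℂ) := by
    have hn : ∀ j : ℕ, ‖Complex.exp (2 * Real.pi * Complex.I / d) ^ j‖ = 1 := by
      intro j
      rw [norm_pow, show (2 * Real.pi * Complex.I / d : ℂ) = ((2 * Real.pi / d : ℝ) : ℂ) * Complex.I by
        push_cast; ring, Complex.norm_exp_ofReal_mul_I, one_pow]
    rw [Unitary.mem_iff]
    constructor
    · rw [Zmat, star_eq_conjTranspose, diagonal_conjTranspose, diagonal_mul_diagonal, ← diagonal_one]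
      congr 1; ext j
      have := hn j
      rw [Pi.star_apply, Complex.star_def, Complex.conj_mul', this]; simp
    · rw [Zmat, star_eq_conjTranspose, diagonal_conjTranspose, diagonal_mul_diagonal, ← diagonal_one]
      congr 1; ext j
      have := hn j
      rw [Pi.star_apply, Complex.star_def, Complex.mul_conj', this]; simp
  exact (Unitary.mem_iff.1 (pow_mem h a)).2

lemma Amat_unit (d a : ℕ) (U : Matrix.unitaryGroup (Fin d) ℂ) :
    Amat d a U * star (Amat d a U) = 1 := by
  have h1 : (U : Matrix (Fin d) (Fin d) ℂ) * star (U : Matrix (Fin d) (Fin d) ℂ) = 1 :=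
    (Unitary.mem_iff.1 U.2).2
  have h2 : star (U : Matrix (Fin d) (Fin d) ℂ) * (U : Matrix (Fin d) (Fin d) ℂ) = 1 :=
    (Unitary.mem_iff.1 U.2).1
  calc _ = star (U : Matrix (Fin d) (Fin d) ℂ) * (Zmat d ^ a * (U * star (U : Matrix (Fin d) (Fin d) ℂ)) * star (Zmat d ^ a)) * U := by
        simp only [Amat, star_mul, star_star, mul_assoc]
    _ = 1 := by rw [h1, mul_one, Z_unit, mul_one, h2]

lemma Amat_trace (d a : ℕ) (hd : 2 ≤ d) (ha1 : 1 ≤ a) (ha2 : a ≤ d - 1) (U : Matrix.unitaryGroup (Fin d) ℂ) :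
    ∑ i, Amat d a U i i = 0 := by
  have h1 : (U : Matrix (Fin d) (Fin d) ℂ) * star (U : Matrix (Fin d) (Fin d) ℂ) = 1 :=
    (Unitary.mem_iff.1 U.2).2
  change (Amat d a U).trace = 0
  rw [Amat, trace_mul_comm, ← mul_assoc, h1, one_mul, Zmat, diagonal_pow, trace_diagonal]
  have hp := Complex.isPrimitiveRoot_exp d (by omega)
  have hne : Complex.exp (2 * Real.pi * Complex.I / d) ^ a ≠ 1 :=
    hp.pow_ne_one_of_pos_of_lt (by omega) (by omega)
  simp only [Pi.pow_apply]
  rw [Fin.sum_univ_eq_sum_range (fun j => (Complex.exp (2 * Real.pi * Complex.I / d) ^ j) ^ a) d]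
  simp only [fun j : ℕ => pow_right_comm (Complex.exp (2 * Real.pi * Complex.I / d)) j a]
  rw [geom_sum_eq hne, pow_right_comm, hp.pow_eq_one]
  simp

noncomputable def T (d a : ℕ) (μ : Measure (Matrix.unitaryGroup (Fin d) ℂ)) (i j k l : Fin d) : ℂ :=
  ∫ U, Amat d a U i k * (starRingEnd ℂ) (Amat d a U j l) ∂μ

lemma T_int (d a : ℕ) (μ : Measure (Matrix.unitaryGroup (Fin d) ℂ)) [IsProbabilityMeasure μ] (i j k l : Fin d) :
    Integrable (fun U => Amat d a U i k * (starRingEnd ℂ) (Amat d a U j l)) μ := by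
  have hc : Continuous (fun U => Amat d a U i k * (starRingEnd ℂ) (Amat d a U j l)) :=
    ((Amat_cont d a).matrix_elem i k).mul (Complex.continuous_conj.comp ((Amat_cont d a).matrix_elem j l))
  have := hc.continuousOn.integrableOn_compact (μ := μ) isCompact_univ
  rwa [integrableOn_univ] at this

lemma T_inv (d a : ℕ) (μ : Measure (Matrix.unitaryGroup (Fin d) ℂ)) [IsProbabilityMeasure μ]
    [μ.IsMulRightInvariant] (W : Matrix.unitaryGroup (Fin d) ℂ) (i j k l : Fin d) :
    T d a μ i j k l = ∫ U, (star (W : Matrix (Fin d) (Fin d) ℂ) * Amat d a U * (W : Matrix (Fin d) (Fin d) ℂ)) i k *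
      (starRingEnd ℂ) ((star (W : Matrix (Fin d) (Fin d) ℂ) * Amat d a U * (W : Matrix (Fin d) (Fin d) ℂ)) j l) ∂μ := by
  have : IsTopologicalGroup (Matrix.unitaryGroup (Fin d) ℂ) := inferInstanceAs (IsTopologicalGroup (unitary _))
  simp only [← Amat_mul]
  exact (integral_mul_right_eq_self (fun U => Amat d a U i k * (starRingEnd ℂ) (Amat d a U j l)) W).symm

/-- permutations -/
lemma T_perm (d a : ℕ) (μ : Measure (Matrix.unitaryGroup (Fin d) ℂ)) [IsProbabilityMeasure μ]
    [μ.IsMulRightInvariant] (s : Equiv.Perm (Fin d)) (i j k l : Fin d) :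
    T d a μ i j k l = T d a μ (s i) (s j) (s k) (s l) := by
  have hW : (s⁻¹).permMatrix ℂ ∈ Matrix.unitaryGroup (Fin d) ℂ := by
    rw [Matrix.mem_unitaryGroup_iff, star_eq_conjTranspose, conjTranspose_permMatrix,
      ← Matrix.permMatrix_mul]
    simp
  rw [T_inv d a μ ⟨_, hW⟩, T]
  congr 1
  ext U
  have h : ∀ i k, (star ((s⁻¹).permMatrix ℂ) * Amat d a U * (s⁻¹).permMatrix ℂ) i k = Amat d a U (s i) (s k) := by
    intro i k
    rw [star_eq_conjTranspose, conjTranspose_permMatrix]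
    simp [Equiv.Perm.permMatrix, PEquiv.toMatrix_toPEquiv_mul, PEquiv.mul_toMatrix_toPEquiv]
    rfl
  simp only [h]

/-- phases -/
lemma T_diag (d a : ℕ) (μ : Measure (Matrix.unitaryGroup (Fin d) ℂ)) [IsProbabilityMeasure μ]
    [μ.IsMulRightInvariant] (w : Fin d → ℂ) (hw : ∀ i, w i * star (w i) = 1) (i j k l : Fin d) :
    T d a μ i j k l = (star (w i) * w k * w j * star (w l)) * T d a μ i j k l := by
  have hW : diagonal w ∈ Matrix.unitaryGroup (Fin d) ℂ := by
    rw [Matrix.mem_unitaryGroup_iff, star_eq_conjTranspose, diagonal_conjTranspose, diagonal_mul_diagonal,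
      ← diagonal_one]
    congr 1; ext j; exact hw j
  conv_lhs => rw [T_inv d a μ ⟨_, hW⟩]
  rw [T, ← integral_const_mul]
  congr 1
  ext U
  simp only [star_eq_conjTranspose, diagonal_conjTranspose, mul_diagonal, diagonal_mul]
  simp
  ring

lemma T_zero (d a : ℕ) (μ : Measure (Matrix.unitaryGroup (Fin d) ℂ)) [IsProbabilityMeasure μ]
    [μ.IsMulRightInvariant] (i j k l : Fin d) (h1 : ¬ (i = k ∧ j = l)) (h2 : ¬ (i = j ∧ k = l)) :
    T d a μ i j k l = 0 := by
  have key : ∀ m, T d a μ i j k l = 0 ∨ (star (if i = m then Complex.I else 1) * (if k = m then Complex.I else 1) *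
      (if j = m then Complex.I else 1) * star (if l = m then Complex.I else 1)) = 1 := by
    intro m
    have := T_diag d a μ (fun x => if x = m then Complex.I else 1) (by intro x; split_ifs <;> simp) i j k l
    by_contra! hc
    exact hc.2 (mul_right_cancel₀ hc.1 (by rw [← this, one_mul]))
  by_contra h0
  have e1 : Complex.I ≠ 1 := by intro h; simpa using congrArg Complex.re h
  have e2 : -Complex.I ≠ 1 := by intro h; simpa using congrArg Complex.re h
  have e3 : (-1 : ℂ) ≠ 1 := by norm_num
  by_cases a1 : i = k
  · have hjl : l ≠ j := fun h => h1 ⟨a1, h.symm⟩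
    have hj := (key j).resolve_left h0
    rw [← a1] at hj
    by_cases b : i = j <;> simp [b, hjl, e1] at hj
  · by_cases a2 : i = j
    · have hkl : l ≠ k := fun h => h2 ⟨a2, h.symm⟩
      have hk := (key k).resolve_left h0
      rw [← a2] at hk
      simp [a1, hkl, e1] at hk
    · have hi := (key i).resolve_left h0
      have a1' := Ne.symm a1
      have a2' := Ne.symm a2
      by_cases b : l = i <;> simp [b, a1', a2', e2, e3] at hi

lemma T_rot (d a : ℕ) (μ : Measure (Matrix.unitaryGroup (Fin d) ℂ)) [IsProbabilityMeasure μ]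
    [μ.IsMulRightInvariant] (p q : Fin d) (hpq : p ≠ q) :
    T d a μ p p p p = T d a μ p q p q + T d a μ p p q q := by
  have hz1 : ((1 + Complex.I) / 2) * ((1 + Complex.I) / 2) = Complex.I / 2 := by
    linear_combination (1 / 4) * Complex.I_mul_I
  have hz2 : ((1 - Complex.I) / 2) * ((1 - Complex.I) / 2) = - Complex.I / 2 := by
    linear_combination (1 / 4) * Complex.I_mul_I
  have hz3 : ((1 + Complex.I) / 2) * ((1 - Complex.I) / 2) = 1 / 2 := by
    linear_combination (-1 / 4) * Complex.I_mul_I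
  set P : Matrix (Fin d) (Fin d) ℂ := (Equiv.swap p q).permMatrix ℂ with hP
  have hPs : Pᴴ = P := by rw [hP, conjTranspose_permMatrix, Equiv.swap_inv]
  have hPP : P * P = 1 := by rw [hP, ← Matrix.permMatrix_mul]; simp
  set W : Matrix (Fin d) (Fin d) ℂ := ((1 + Complex.I) / 2) • 1 + ((1 - Complex.I) / 2) • P with hWdef
  have hWs : star W = ((1 - Complex.I) / 2) • 1 + ((1 + Complex.I) / 2) • P := by
    rw [hWdef, star_eq_conjTranspose, conjTranspose_add, conjTranspose_smul, conjTranspose_smul, hPs]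
    simp [sub_eq_add_neg]
  have hW : W ∈ Matrix.unitaryGroup (Fin d) ℂ := by
    rw [Matrix.mem_unitaryGroup_iff, hWs, hWdef]
    simp only [add_mul, mul_add, smul_mul_smul_comm, one_mul, mul_one, hPP]
    rw [hz1, hz2, hz3, mul_comm ((1 - Complex.I) / 2), hz3]
    module
  have s1 : star ((1 + Complex.I) / 2) = (1 - Complex.I) / 2 := by simp [sub_eq_add_neg]
  have s2 : star ((1 - Complex.I) / 2) = (1 + Complex.I) / 2 := by simp
  let e : Fin 2 → Fin d := ![p, q]
  let c : Fin 2 → ℂ := ![(1 + Complex.I) / 2, (1 - Complex.I) / 2]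
  have h : ∀ A : Matrix (Fin d) (Fin d) ℂ, (star W * A * W) p p =
      ∑ s, ∑ t, star (c s) * c t * A (e s) (e t) := by
    intro A
    rw [hWs, hWdef]
    simp only [Fin.sum_univ_two, e, c, Matrix.cons_val_zero, Matrix.cons_val_one, s1, s2]
    simp [add_mul, mul_add, hP, Equiv.Perm.permMatrix, PEquiv.toMatrix_toPEquiv_mul,
      PEquiv.mul_toMatrix_toPEquiv]
    ring
  have h2 : T d a μ p p p p = ∑ s, ∑ t, ∑ s', ∑ t', (star (c s) * c t * (c s' * star (c t'))) *
      T d a μ (e s) (e s') (e t) (e t') := by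
    rw [T_inv d a μ ⟨W, hW⟩]
    have hI := fun x : Fin 2 × Fin 2 × Fin 2 × Fin 2 =>
      (T_int d a μ (e x.1) (e x.2.2.1) (e x.2.1) (e x.2.2.2)).const_mul
      (star (c x.1) * c x.2.1 * (c x.2.2.1 * star (c x.2.2.2)))
    have h3 := integral_finsetSum Finset.univ (fun x _ => hI x)
    simp only [integral_const_mul] at h3
    simp only [Fintype.sum_prod_type] at h3
    refine Eq.trans ?_ h3
    congr 1
    funext U
    simp only [h, Fin.sum_univ_two, map_add, map_mul, Complex.star_def, Complex.conj_conj]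
    ring
  have hqp := hpq.symm
  have hsw1 : T d a μ q q q q = T d a μ p p p p := by
    rw [T_perm d a μ (Equiv.swap p q) q q q q]; simp
  have hsw2 : T d a μ q p q p = T d a μ p q p q := by
    rw [T_perm d a μ (Equiv.swap p q) q p q p]; simp
  have hsw3 : T d a μ q q p p = T d a μ p p q q := by
    rw [T_perm d a μ (Equiv.swap p q) q q p p]; simp
  have hz : ∀ i j k l, ¬ (i = k ∧ j = l) → ¬ (i = j ∧ k = l) → T d a μ i j k l = 0 := T_zero d a μ
  simp only [Fin.sum_univ_two, e, c, Matrix.cons_val_zero, Matrix.cons_val_one] at h2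
  rw [hz p q p p (by simp [hqp]) (by simp [hpq]), hz p p p q (by simp [hpq]) (by simp [hpq]),
    hz p p q p (by simp [hpq]) (by simp [hqp]), hz q p p p (by simp [hqp]) (by simp [hqp]),
    hz q q q p (by simp [hqp]) (by simp [hqp]), hz q q p q (by simp [hqp]) (by simp [hpq]),
    hz q p q q (by simp [hpq]) (by simp [hqp]), hz p q q q (by simp [hpq]) (by simp [hpq]),
    hz p q q p (by simp [hpq]) (by simp [hpq]), hz q p p q (by simp [hqp]) (by simp [hqp]),
    hsw1, hsw2, hsw3] at h2
  rw [s1, s2] at h2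
  have hz4 := hz3
  rw [mul_comm] at hz4
  simp only [hz1, hz2, hz3, hz4] at h2
  linear_combination 2 * h2 - T d a μ p p q q * Complex.I_mul_I

lemma perm2 {d : ℕ} (i j p q : Fin d) (hij : i ≠ j) (hpq : p ≠ q) :
    ∃ s : Equiv.Perm (Fin d), s i = p ∧ s j = q := by
  refine ⟨Equiv.swap (Equiv.swap i p j) q * Equiv.swap i p, ?_, ?_⟩
  · rw [Equiv.Perm.mul_apply, Equiv.swap_apply_left, Equiv.swap_apply_of_ne_of_ne _ hpq]
    intro h
    have := congrArg (Equiv.swap i p) h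
    simp at this
    exact hij this
  · simp

lemma T_vals (d a : ℕ) (hd : 2 ≤ d) (ha1 : 1 ≤ a) (ha2 : a ≤ d - 1)
    (μ : Measure (Matrix.unitaryGroup (Fin d) ℂ)) [IsProbabilityMeasure μ]
    [μ.IsMulRightInvariant] (p q : Fin d) (hpq : p ≠ q) :
    T d a μ p p p p = 1 / (d + 1) ∧ T d a μ p q p q = - 1 / (d ^ 2 - 1) ∧
      T d a μ p p q q = d / (d ^ 2 - 1) := by
  have hrot := T_rot d a μ p q hpq
  have hb : ∀ j, j ≠ p → T d a μ p j p j = T d a μ p q p q := by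
    intro j hj
    obtain ⟨s, h1, h2⟩ := perm2 p j p q hj.symm hpq
    rw [T_perm d a μ s p j p j, h1, h2]
  have hg : ∀ j, j ≠ p → T d a μ p p j j = T d a μ p p q q := by
    intro j hj
    obtain ⟨s, h1, h2⟩ := perm2 p j p q hj.symm hpq
    rw [T_perm d a μ s p p j j, h1, h2]
  have hs : ∀ f : Fin d → ℂ, ∀ v, (∀ j, j ≠ p → f j = v) → ∑ j, f j = f p + (d - 1) * v := by
    intro f v hf
    rw [← Finset.add_sum_erase _ _ (Finset.mem_univ p),
      Finset.sum_congr rfl (fun j hj => hf j (Finset.ne_of_mem_erase hj))]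
    simp [Finset.card_erase_of_mem, Nat.cast_sub (show 1 ≤ d by omega)]
  have e1 : ∑ j, T d a μ p j p j = 0 := by
    simp only [T]
    rw [← integral_finsetSum _ (fun j _ => T_int d a μ p j p j)]
    simp only [← Finset.mul_sum, ← map_sum, Amat_trace d a hd ha1 ha2]
    simp
  have e2 : ∑ j, T d a μ p p j j = 1 := by
    simp only [T]
    rw [← integral_finsetSum _ (fun j _ => T_int d a μ p p j j)]
    have : ∀ U, ∑ j, Amat d a U p j * (starRingEnd ℂ) (Amat d a U p j) = 1 := by
      intro U
      have := congrFun (congrFun (Amat_unit d a U) p) p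
      simpa [Matrix.mul_apply] using this
    simp [this]
  rw [hs _ _ hb] at e1
  rw [hs _ _ hg] at e2
  have hd1 : (d : ℂ) + 1 ≠ 0 := by exact_mod_cast Nat.succ_ne_zero d
  have hd2 : (d : ℂ) - 1 ≠ 0 := by
    rw [sub_ne_zero]; exact_mod_cast (by omega : d ≠ 1)
  have hd3 : (d : ℂ) ^ 2 - 1 ≠ 0 := by
    rw [show (d : ℂ) ^ 2 - 1 = (d + 1) * (d - 1) by ring]; exact mul_ne_zero hd1 hd2
  have ea : T d a μ p p p p * (d + 1) = 1 := by
    linear_combination (d - 1) * hrot + e1 + e2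
  refine ⟨by rw [eq_div_iff hd1, ea], ?_, ?_⟩
  · rw [eq_div_iff hd3]
    linear_combination (d + 1) * e1 - ea
  · rw [eq_div_iff hd3]
    linear_combination (d + 1) * e2 - ea

/-- Twirling identity: the Haar average of (U†ZᵃU) ⊗ conj(U†ZᵃU) over the unitary group
equals Φ − (1/(d²−1)) • (I − Φ), for 1 ≤ a ≤ d−1.  Here μ is the Haar probability
measure on the unitary group, characterized as a left-invariant probability measure. -/
theorem stmt_13 (d : ℕ) (hd : 2 ≤ d)
    (μ : Measure (Matrix.unitaryGroup (Fin d) ℂ)) [IsProbabilityMeasure μ]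
    (hinv : ∀ V : Matrix.unitaryGroup (Fin d) ℂ, Measure.map (fun U => V * U) μ = μ)
    (a : ℕ) (ha1 : 1 ≤ a) (ha2 : a ≤ d - 1) :
    (∫ U : Matrix.unitaryGroup (Fin d) ℂ,
        ((star (U : Matrix (Fin d) (Fin d) ℂ) * (Zmat d) ^ a * (U : Matrix (Fin d) (Fin d) ℂ)) ⊗ₖ
          ((star (U : Matrix (Fin d) (Fin d) ℂ) * (Zmat d) ^ a *
              (U : Matrix (Fin d) (Fin d) ℂ)).map (starRingEnd ℂ))) ∂μ) =
      Phi d - (((d : ℂ) ^ 2 - 1))⁻¹ • ((1 : Matrix (Fin d × Fin d) (Fin d × Fin d) ℂ) - Phi d) := by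
  have := right_inv d μ hinv
  change (∫ U, (Amat d a U) ⊗ₖ ((Amat d a U).map (starRingEnd ℂ)) ∂μ) = _
  ext ⟨i, j⟩ ⟨k, l⟩
  have hI : ∀ x y : Fin d × Fin d, Integrable
      (fun U => ((Amat d a U) ⊗ₖ ((Amat d a U).map (starRingEnd ℂ))) x y) μ :=
    fun x y => T_int d a μ x.1 x.2 y.1 y.2
  have hL : (∫ U, (Amat d a U) ⊗ₖ ((Amat d a U).map (starRingEnd ℂ)) ∂μ) (i, j) (k, l)
      = T d a μ i j k l := by
    have h1 := eval_integral (μ := μ) (E := fun _ : Fin d × Fin d => (Fin d × Fin d → ℂ))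
      (f := fun U => (Amat d a U) ⊗ₖ ((Amat d a U).map (starRingEnd ℂ)))
      (fun x => Integrable.of_eval (fun y => hI x y)) (i, j)
    have h2 := eval_integral (μ := μ) (E := fun _ : Fin d × Fin d => ℂ)
      (f := fun U => ((Amat d a U) ⊗ₖ ((Amat d a U).map (starRingEnd ℂ))) (i, j))
      (fun y => hI (i, j) y) (k, l)
    exact (congrFun h1 (k, l)).trans h2
  rw [hL]
  have hd0 : (d : ℂ) ≠ 0 := by exact_mod_cast (by omega : d ≠ 0)
  have hd1 : (d : ℂ) + 1 ≠ 0 := by exact_mod_cast Nat.succ_ne_zero d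
  have hd2 : (d : ℂ) - 1 ≠ 0 := by
    rw [sub_ne_zero]; exact_mod_cast (by omega : d ≠ 1)
  have hd3 : (d : ℂ) ^ 2 - 1 ≠ 0 := by
    rw [show (d : ℂ) ^ 2 - 1 = (d + 1) * (d - 1) by ring]; exact mul_ne_zero hd1 hd2
  have hv := T_vals d a hd ha1 ha2 μ
  simp only [Matrix.sub_apply, Matrix.smul_apply, Phi, Matrix.one_apply, Prod.mk.injEq, smul_eq_mul]
  by_cases h1 : i = k ∧ j = l
  · obtain ⟨rfl, rfl⟩ := h1
    by_cases hij : i = j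
    · subst hij
      have : Nontrivial (Fin d) := Fin.nontrivial_iff_two_le.2 hd
      obtain ⟨q, hq⟩ := exists_ne i
      rw [(hv i q hq.symm).1]
      simp only [and_self, if_true]
      rw [show (d : ℂ) ^ 2 - 1 = (d + 1) * (d - 1) by ring]
      field_simp
      ring
    · rw [(hv i j hij).2.1]
      simp [hij]
      ring
  · by_cases h2 : i = j ∧ k = l
    · obtain ⟨rfl, rfl⟩ := h2
      have hik : i ≠ k := fun h => h1 ⟨h, h⟩
      rw [(hv i k hik).2.2]
      simp [hik]
      field_simp
      ring
    · rw [T_zero d a μ i j k l h1 h2]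
      simp [h1, h2]
end
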